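/- arXiv:2605.08878 — 4 statements merged into one kernel-verified Lean document; each statement's English description precedes it below -/
import Mathlib

section
/- Let T ≥ 1, let E_0, …, E_T be finite-dimensional real inner product spaces, and let J_t : E_t →ₗ[ℝ] E_{t+1} be linear maps for t = 0, …, T−1. Let 𝒰_0 be a submodule of E_0 and define forward subspaces 𝒰_{t+1} = 𝒰_t.map J_t. Fix Y ∈ E_T and define backward directions G_T = Y and G_t = J_t† G_{t+1}; aligned components A_t = P_{𝒰_t} G_t; remainders R_t = P_{𝒰_tᗮ} G_t; and leakage sources B_t = P_{𝒰_tᗮ}(J_t† A_{t+1}) for t = 0, …, T−1. Then for every t = 0, …, T−1, R_t = B_t + J_t† R_{t+1}. -/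
open Submodule

/-- Orthogonal projection onto a submodule, viewed as a linear map into the ambient space. -/
noncomputable def projL {E : Type*} [NormedAddCommGroup E] [InnerProductSpace ℝ E]
    [FiniteDimensional ℝ E] (S : Submodule ℝ E) : E →ₗ[ℝ] E :=
  S.subtype ∘ₗ (orthogonalProjection S).toLinearMap

theorem red_recurrence
    {T : ℕ} (hT : 1 ≤ T)
    {E : ℕ → Type*}
    [∀ t, NormedAddCommGroup (E t)] [∀ t, InnerProductSpace ℝ (E t)]
    [∀ t, FiniteDimensional ℝ (E t)]
    (J : ∀ t, E t →ₗ[ℝ] E (t + 1))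
    (𝒰₀ : Submodule ℝ (E 0))
    (U : ∀ t, Submodule ℝ (E t))
    (hU0 : U 0 = 𝒰₀)
    (hU : ∀ t, t < T → U (t + 1) = (U t).map (J t))
    (Y : E T)
    (G : ∀ t, E t)
    (hGT : G T = Y)
    (hG : ∀ t, t < T → G t = LinearMap.adjoint (J t) (G (t + 1)))
    (A R : ∀ t, E t)
    (hA : ∀ t, t ≤ T → A t = projL (U t) (G t))
    (hR : ∀ t, t ≤ T → R t = projL (U t)ᗮ (G t))
    (B : ∀ t, E t)
    (hB : ∀ t, t < T → B t = projL (U t)ᗮ (LinearMap.adjoint (J t) (A (t + 1)))) :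
    ∀ t, t < T → R t = B t + LinearMap.adjoint (J t) (R (t + 1)) := by
  intro t ht
  have hsum : A (t + 1) + R (t + 1) = G (t + 1) := by
    rw [hA _ ht, hR _ ht]
    simp only [projL, LinearMap.comp_apply]
    exact Submodule.starProjection_add_starProjection_orthogonal (K := U (t + 1)) (G (t + 1))
  have hRmem : R (t + 1) ∈ (U (t + 1))ᗮ := by
    rw [hR _ ht]
    exact Subtype.property _
  have hmem : LinearMap.adjoint (J t) (R (t + 1)) ∈ (U t)ᗮ := by
    rw [Submodule.mem_orthogonal]
    intro u hu
    rw [LinearMap.adjoint_inner_right]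
    refine (Submodule.mem_orthogonal _ _).1 hRmem _ ?_
    rw [hU t ht]
    exact Submodule.mem_map_of_mem hu
  have hfix : projL (U t)ᗮ (LinearMap.adjoint (J t) (R (t + 1)))
      = LinearMap.adjoint (J t) (R (t + 1)) :=
    Submodule.starProjection_eq_self_iff.2 hmem
  rw [hR t ht.le, hB t ht, hG t ht, ← hsum, map_add, map_add, hfix]
end

section
/- Let T ≥ 1, let E_0, …, E_T be finite-dimensional real inner product spaces, and let J_t : E_t →ₗ[ℝ] E_{t+1} be linear maps for t = 0, …, T−1. Let 𝒰_0 be a submodule of E_0 and define 𝒰_{t+1} = 𝒰_t.map J_t. Fix Y ∈ E_T and define G_T = Y, G_t = J_t† G_{t+1}, A_t = P_{𝒰_t} G_t, R_t = P_{𝒰_tᗮ} G_t, and B_t = P_{𝒰_tᗮ}(J_t† A_{t+1}). Then for every s with 0 ≤ s ≤ T−1, R_0 = Σ_{j=0}^{s} (J_0† ∘ ⋯ ∘ J_{j−1}†) B_j + (J_0† ∘ ⋯ ∘ J_s†) R_{s+1}, where the empty composition (for j = 0) is the identity map. -/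
open Submodule

theorem red_partial_decomposition
    {T : ℕ} (hT : 1 ≤ T)
    {E : ℕ → Type*}
    [∀ t, NormedAddCommGroup (E t)] [∀ t, InnerProductSpace ℝ (E t)]
    [∀ t, FiniteDimensional ℝ (E t)]
    (J : ∀ t, E t →ₗ[ℝ] E (t + 1))
    (𝒰₀ : Submodule ℝ (E 0))
    (U : ∀ t, Submodule ℝ (E t))
    (hU0 : U 0 = 𝒰₀)
    (hU : ∀ t, t < T → U (t + 1) = (U t).map (J t))
    (Y : E T)
    (G : ∀ t, E t)
    (hGT : G T = Y)
    (hG : ∀ t, t < T → G t = LinearMap.adjoint (J t) (G (t + 1)))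
    (A R : ∀ t, E t)
    (hA : ∀ t, t ≤ T → A t = projL (U t) (G t))
    (hR : ∀ t, t ≤ T → R t = projL (U t)ᗮ (G t))
    (B : ∀ t, E t)
    (hB : ∀ t, t < T → B t = projL (U t)ᗮ (LinearMap.adjoint (J t) (A (t + 1))))
    -- `K j` is the cumulative adjoint transport `J₀† ∘ ⋯ ∘ J_{j−1}†`, the identity for `j = 0`.
    (K : ∀ j, E j →ₗ[ℝ] E 0)
    (hK0 : K 0 = LinearMap.id)
    (hK : ∀ j, j < T → K (j + 1) = (K j) ∘ₗ LinearMap.adjoint (J j)) :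
    ∀ s, s < T →
      R 0 = (∑ j ∈ Finset.range (s + 1), K j (B j)) + K (s + 1) (R (s + 1)) := by
  have step : ∀ t, t < T → R t = B t + LinearMap.adjoint (J t) (R (t + 1)) := by
    intro t ht
    have hsum : G (t + 1) = A (t + 1) + R (t + 1) := by
      rw [hA _ ht, hR _ ht]
      exact (Submodule.starProjection_add_starProjection_orthogonal
        (K := U (t + 1)) (G (t + 1))).symm
    have hmemR : R (t + 1) ∈ (U (t + 1))ᗮ := by
      rw [hR _ ht]
      exact Submodule.coe_mem _
    have hmem : LinearMap.adjoint (J t) (R (t + 1)) ∈ (U t)ᗮ := by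
      rw [Submodule.mem_orthogonal]
      intro u hu
      rw [LinearMap.adjoint_inner_right]
      refine (Submodule.mem_orthogonal _ _).1 hmemR _ ?_
      rw [hU t ht]
      exact Submodule.mem_map_of_mem hu
    have hfix : projL (U t)ᗮ (LinearMap.adjoint (J t) (R (t + 1)))
        = LinearMap.adjoint (J t) (R (t + 1)) :=
      Submodule.starProjection_eq_self_iff.2 hmem
    rw [hR t ht.le, hG t ht, hsum, map_add, map_add, hfix, hB t ht]
  intro s
  induction s with
  | zero =>
    intro h
    have h1 := step 0 h
    rw [Finset.sum_range_one, hK 0 h, hK0]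
    exact h1
  | succ n ih =>
    intro h
    rw [ih (by omega), Finset.sum_range_succ _ (n + 1), hK (n + 1) h, step (n + 1) h, map_add,
      LinearMap.comp_apply]
    exact (add_assoc _ _ _).symm
end

section
/- Let T ≥ 1, let E_0, …, E_T be finite-dimensional real inner product spaces, and let J_t : E_t →ₗ[ℝ] E_{t+1} be linear maps for t = 0, …, T−1. Let 𝒰_0 be a submodule of E_0 and define 𝒰_{t+1} = 𝒰_t.map J_t. Fix Y ∈ E_T and define G_T = Y, G_t = J_t† G_{t+1}, A_t = P_{𝒰_t} G_t, R_t = P_{𝒰_tᗮ} G_t, and leakage sources B_t = P_{𝒰_tᗮ}(J_t† A_{t+1}). Then the refusal-escape direction satisfies the exact decomposition P_{𝒰_0ᗮ}((J_{T−1} ∘ ⋯ ∘ J_0)† Y) = R_0 = Σ_{t=0}^{T−1} (J_0† ∘ ⋯ ∘ J_{t−1}†) B_t + (J_0† ∘ ⋯ ∘ J_{T−1}†) R_T, where the empty composition is the identity map and R_T = P_{𝒰_Tᗮ} Y is the terminal source. -/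
open Submodule

theorem red_exact_decomposition
    {T : ℕ} (hT : 1 ≤ T)
    {E : ℕ → Type*}
    [∀ t, NormedAddCommGroup (E t)] [∀ t, InnerProductSpace ℝ (E t)]
    [∀ t, FiniteDimensional ℝ (E t)]
    (J : ∀ t, E t →ₗ[ℝ] E (t + 1))
    (𝒰₀ : Submodule ℝ (E 0))
    (U : ∀ t, Submodule ℝ (E t))
    (hU0 : U 0 = 𝒰₀)
    (hU : ∀ t, t < T → U (t + 1) = (U t).map (J t))
    (Y : E T)
    (G : ∀ t, E t)
    (hGT : G T = Y)
    (hG : ∀ t, t < T → G t = LinearMap.adjoint (J t) (G (t + 1)))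
    (A R : ∀ t, E t)
    (hA : ∀ t, t ≤ T → A t = projL (U t) (G t))
    (hR : ∀ t, t ≤ T → R t = projL (U t)ᗮ (G t))
    (B : ∀ t, E t)
    (hB : ∀ t, t < T → B t = projL (U t)ᗮ (LinearMap.adjoint (J t) (A (t + 1))))
    -- `K j` is the cumulative adjoint transport `J₀† ∘ ⋯ ∘ J_{j−1}†`, the identity for `j = 0`.
    (K : ∀ j, E j →ₗ[ℝ] E 0)
    (hK0 : K 0 = LinearMap.id)
    (hK : ∀ j, j < T → K (j + 1) = (K j) ∘ₗ LinearMap.adjoint (J j))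
    -- `C t` is the forward composition `J_{t−1} ∘ ⋯ ∘ J₀`, the identity for `t = 0`.
    (C : ∀ t, E 0 →ₗ[ℝ] E t)
    (hC0 : C 0 = LinearMap.id)
    (hC : ∀ t, t < T → C (t + 1) = (J t) ∘ₗ C t) :
    projL 𝒰₀ᗮ (LinearMap.adjoint (C T) Y) = R 0 ∧
    R 0 = (∑ t ∈ Finset.range T, K t (B t)) + K T (R T) ∧
    R T = projL (U T)ᗮ Y := by
  have hadj : ∀ t, t ≤ T → LinearMap.adjoint (C t) (G t) = G 0 := by
    intro t
    induction t with
    | zero =>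
      intro _
      refine ext_inner_right ℝ fun v => ?_
      rw [LinearMap.adjoint_inner_left, hC0, LinearMap.id_apply]
    | succ n ih =>
      intro h
      rw [hC n h, LinearMap.adjoint_comp, LinearMap.comp_apply, ← hG n h, ih (by omega)]
  have hstep : ∀ t, t < T → R t = B t + LinearMap.adjoint (J t) (R (t + 1)) := by
    intro t h
    have hsplit : G (t + 1) = A (t + 1) + R (t + 1) := by
      rw [hA _ h, hR _ h]
      exact (Submodule.starProjection_add_starProjection_orthogonal (K := U (t + 1)) (G (t + 1))).symm
    have hmem : LinearMap.adjoint (J t) (R (t + 1)) ∈ (U t)ᗮ := by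
      rw [Submodule.mem_orthogonal]
      intro u hu
      rw [LinearMap.adjoint_inner_right]
      have hRm : R (t + 1) ∈ (U (t + 1))ᗮ := by
        rw [hR _ h]
        exact (orthogonalProjection (U (t + 1))ᗮ (G (t + 1))).2
      refine (Submodule.mem_orthogonal _ _).1 hRm _ ?_
      rw [hU t h]
      exact Submodule.mem_map_of_mem hu
    have hfix : projL (U t)ᗮ (LinearMap.adjoint (J t) (R (t + 1)))
        = LinearMap.adjoint (J t) (R (t + 1)) :=
      Submodule.starProjection_eq_self_iff.2 hmem
    rw [hR t h.le, hG t h, hsplit, map_add, map_add, hfix, hB t h]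
  have hsum : ∀ n, n ≤ T → R 0 = (∑ t ∈ Finset.range n, K t (B t)) + K n (R n) := by
    intro n
    induction n with
    | zero => intro _; simp [hK0]
    | succ n ih =>
      intro h
      rw [ih (by omega), Finset.sum_range_succ, hK n h, LinearMap.comp_apply, add_assoc,
        ← map_add, ← hstep n h]
  refine ⟨?_, hsum T le_rfl, ?_⟩
  · rw [← hGT, hadj T le_rfl, hR 0 (Nat.zero_le _), hU0]
  · rw [hR T le_rfl, hGT]
end

section
/- Let E be a finite-dimensional real inner product space and J_N, J_A : E →ₗ[ℝ] E linear maps (the Jacobians of the attention pre-normalization and of the attention operator). Let 𝒰_X be a submodule of E, and define 𝒰_P = 𝒰_X.map J_N, 𝒰_O = 𝒰_P.map J_A, and 𝒰_Z = 𝒰_X.map (id + J_A ∘ J_N). For G_Z ∈ E, let A_Z = P_{𝒰_Z} G_Z. Then the attention-block leakage source decomposes exactly into four terms: P_{𝒰_Xᗮ}((id + J_A ∘ J_N)† A_Z) = P_{𝒰_Xᗮ}(A_Z) + J_N†(J_A†(P_{𝒰_Oᗮ} A_Z)) + J_N†(P_{𝒰_Pᗮ}(J_A†(P_{𝒰_O}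 A_Z))) + P_{𝒰_Xᗮ}(J_N†(P_{𝒰_P}(J_A†(P_{𝒰_O} A_Z)))). -/
open Submodule

/-- The projections onto a subspace and its complement sum to the identity. -/
theorem projL_add_compl {E : Type*} [NormedAddCommGroup E] [InnerProductSpace ℝ E]
    [FiniteDimensional ℝ E] (S : Submodule ℝ E) (v : E) : projL S v + projL Sᗮ v = v :=
  S.starProjection_add_starProjection_orthogonal v

theorem projL_mem {E : Type*} [NormedAddCommGroup E] [InnerProductSpace ℝ E]
    [FiniteDimensional ℝ E] (S : Submodule ℝ E) (v : E) : projL S v ∈ S :=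
  (orthogonalProjection S v).2

theorem projL_of_mem {E : Type*} [NormedAddCommGroup E] [InnerProductSpace ℝ E]
    [FiniteDimensional ℝ E] (S : Submodule ℝ E) (v : E) (h : v ∈ S) : projL S v = v :=
  Submodule.starProjection_eq_self_iff.2 h

/-- The adjoint maps the complement of the image into the complement of the source. -/
theorem adjoint_mem_compl {E : Type*} [NormedAddCommGroup E] [InnerProductSpace ℝ E]
    [FiniteDimensional ℝ E] (J : E →ₗ[ℝ] E) (S : Submodule ℝ E) (v : E)
    (h : v ∈ (S.map J)ᗮ) : LinearMap.adjoint J v ∈ Sᗮ := by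
  rw [Submodule.mem_orthogonal] at h ⊢
  intro u hu
  rw [LinearMap.adjoint_inner_right]
  exact h _ (Submodule.mem_map_of_mem hu)

theorem attention_block_leakage_decomposition
    {E : Type*} [NormedAddCommGroup E] [InnerProductSpace ℝ E] [FiniteDimensional ℝ E]
    (J_N J_A : E →ₗ[ℝ] E) (𝒰X : Submodule ℝ E) (G_Z : E)
    (𝒰P : Submodule ℝ E) (hUP : 𝒰P = 𝒰X.map J_N)
    (𝒰O : Submodule ℝ E) (hUO : 𝒰O = 𝒰P.map J_A)
    (𝒰Z : Submodule ℝ E) (hUZ : 𝒰Z = 𝒰X.map (LinearMap.id + J_A ∘ₗ J_N))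
    (A_Z : E) (hAZ : A_Z = projL 𝒰Z G_Z) :
    projL 𝒰Xᗮ (LinearMap.adjoint (LinearMap.id + J_A ∘ₗ J_N) A_Z) =
      projL 𝒰Xᗮ A_Z
      + LinearMap.adjoint J_N (LinearMap.adjoint J_A (projL 𝒰Oᗮ A_Z))
      + LinearMap.adjoint J_N (projL 𝒰Pᗮ (LinearMap.adjoint J_A (projL 𝒰O A_Z)))
      + projL 𝒰Xᗮ
          (LinearMap.adjoint J_N (projL 𝒰P (LinearMap.adjoint J_A (projL 𝒰O A_Z)))) := by
  subst hUP hUO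
  have h1 := projL_of_mem _ _ (adjoint_mem_compl J_N 𝒰X _
    (adjoint_mem_compl J_A (𝒰X.map J_N) _ (projL_mem _ A_Z)))
  have h2 := projL_of_mem _ _ (adjoint_mem_compl J_N 𝒰X _
    (projL_mem _ (LinearMap.adjoint J_A (projL ((𝒰X.map J_N).map J_A) A_Z))))
  have e : LinearMap.adjoint (LinearMap.id + J_A ∘ₗ J_N) A_Z
      = A_Z + LinearMap.adjoint J_N (LinearMap.adjoint J_A A_Z) := by
    rw [map_add, LinearMap.adjoint_comp, LinearMap.adjoint_id]
    rfl
  have e1 := projL_add_compl ((𝒰X.map J_N).map J_A) A_Z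
  have e2 := projL_add_compl (𝒰X.map J_N)
    (LinearMap.adjoint J_A (projL ((𝒰X.map J_N).map J_A) A_Z))
  have e3 : LinearMap.adjoint J_N (LinearMap.adjoint J_A A_Z) =
      LinearMap.adjoint J_N (LinearMap.adjoint J_A (projL ((𝒰X.map J_N).map J_A)ᗮ A_Z))
      + LinearMap.adjoint J_N (projL (𝒰X.map J_N)ᗮ
          (LinearMap.adjoint J_A (projL ((𝒰X.map J_N).map J_A) A_Z)))
      + LinearMap.adjoint J_N (projL (𝒰X.map J_N)
          (LinearMap.adjoint J_A (projL ((𝒰X.map J_N).map J_A) A_Z))) := by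
    conv_lhs => rw [← e1, map_add, map_add, ← e2, map_add]
    abel
  rw [e, map_add, e3, map_add, map_add, h1, h2]
  abel
end
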